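/- Let a be a standard real Gaussian vector in ℝⁿ (a ~ N(0, I)) and z ∈ ℝⁿ a fixed nonzero vector. Then E[(1/√3 − exp(−(aᵀz)²/‖z‖²)) · a aᵀ] = (2√3/(9‖z‖²)) · z zᵀ. -/

import Mathlib

open MeasureTheory ProbabilityTheory

/-- The law of a standard real Gaussian vector in ℝⁿ (a ~ N(0, I)). -/
noncomputable def stdRealGaussian (n : ℕ) : Measure (Fin n → ℝ) :=
  Measure.pi fun _ => gaussianReal 0 1

lemma aux_tilt (f : ℝ → ℝ) : ∫ x, Real.exp (-x^2) * f x ∂(gaussianReal 0 1)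
   = 1 / √3 * ∫ x, f x ∂(gaussianReal 0 (1/3)) := by
  rw [integral_gaussianReal_eq_integral_smul (by norm_num),
    integral_gaussianReal_eq_integral_smul (by norm_num), ← integral_const_mul]
  congr 1
  ext x
  simp only [gaussianPDFReal, smul_eq_mul]
  have h1 : Real.exp (-(x-0)^2/(2*((1/3 : NNReal):ℝ))) = Real.exp (-(x-0)^2/(2*((1 : NNReal):ℝ))) * Real.exp (-x^2) := by
    rw [← Real.exp_add]; congr 1; push_cast; ring
  have h2 : √(2 * Real.pi * ((1 : NNReal):ℝ)) = √3 * √(2 * Real.pi * ((1/3 : NNReal):ℝ)) := by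
    rw [← Real.sqrt_mul (by norm_num)]; congr 1; push_cast; ring
  rw [h1, h2, mul_inv]
  ring

lemma aux_sq (v : NNReal) : ∫ x, x^2 ∂(gaussianReal 0 v) = v := by
  have := variance_of_integral_eq_zero (X := id) (μ := gaussianReal 0 v) (by fun_prop) (by simp)
  rw [variance_id_gaussianReal] at this
  simpa using this.symm

lemma aux_int_sq : Integrable (fun x : ℝ => x^2) (gaussianReal 0 1) :=
  (memLp_id_gaussianReal 2).integrable_sq

lemma aux_int_id : Integrable (fun x : ℝ => x) (gaussianReal 0 1) :=
  (memLp_id_gaussianReal 1).integrable (by simp)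

lemma aux_int_exp {f : ℝ → ℝ} (hf : Integrable f (gaussianReal 0 1)) :
    Integrable (fun x => Real.exp (-x^2) * f x) (gaussianReal 0 1) := by
  refine hf.bdd_mul (c := 1) (by fun_prop) (Filter.Eventually.of_forall fun x => ?_)
  rw [Real.norm_eq_abs, Real.abs_exp, Real.exp_le_one_iff]
  nlinarith [sq_nonneg x]

lemma aux_int_w {f : ℝ → ℝ} (hf : Integrable f (gaussianReal 0 1)) :
    Integrable (fun x => (1/√3 - Real.exp (-x^2)) * f x) (gaussianReal 0 1) := by
  simp only [sub_mul]
  exact (hf.const_mul _).sub (aux_int_exp hf)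

lemma aux_w {f : ℝ → ℝ} (hf : Integrable f (gaussianReal 0 1)) :
    ∫ x, (1/√3 - Real.exp (-x^2)) * f x ∂(gaussianReal 0 1)
    = 1/√3 * (∫ x, f x ∂(gaussianReal 0 1) - ∫ x, f x ∂(gaussianReal 0 (1/3))) := by
  simp only [sub_mul]
  rw [integral_sub (hf.const_mul _) (aux_int_exp hf), aux_tilt, integral_const_mul]
  ring

lemma aux_w0 : ∫ x, (1/√3 - Real.exp (-x^2)) ∂(gaussianReal 0 1) = 0 := by
  have := aux_w (f := fun _ => 1) (integrable_const _)
  simpa using this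

lemma aux_w2 : ∫ x, (1/√3 - Real.exp (-x^2)) * x ^ 2 ∂(gaussianReal 0 1) = 2 * √3 / 9 := by
  rw [aux_w aux_int_sq, aux_sq, aux_sq]
  have h : √3 * √3 = 3 := Real.mul_self_sqrt (by norm_num)
  have h0 : √3 ≠ 0 := by positivity
  push_cast
  field_simp
  nlinarith

noncomputable def auxF {n : ℕ} (o k l m : Fin n) (x : ℝ) : ℝ :=
  (if m = o then (1/√3 - Real.exp (-x^2)) else 1) * ((if m = k then x else 1) * (if m = l then x else 1))

lemma auxF_int {n : ℕ} (o k l m : Fin n) : Integrable (auxF o k l m) (gaussianReal 0 1) := by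
  have h : Integrable (fun x : ℝ => (if m = k then x else 1) * (if m = l then x else 1)) (gaussianReal 0 1) := by
    split_ifs
    · simpa [sq] using aux_int_sq
    · simpa using aux_int_id
    · simpa using aux_int_id
    · simp
  unfold auxF
  by_cases h1 : m = o
  · simp only [if_pos h1]
    exact aux_int_w h
  · simp only [if_neg h1, one_mul]
    exact h

lemma auxF_prod {n : ℕ} (o k l : Fin n) (x : Fin n → ℝ) :
    (1/√3 - Real.exp (-(x o)^2)) * (x k * x l) = ∏ m, auxF o k l m (x m) := by
  simp only [auxF, Finset.prod_mul_distrib, Finset.prod_ite_eq', Finset.mem_univ, if_true]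

lemma aux_pi_int {n : ℕ} (o k l : Fin n) :
    Integrable (fun x : Fin n → ℝ => (1/√3 - Real.exp (-(x o)^2)) * (x k * x l)) (Measure.pi fun _ => gaussianReal 0 1) := by
  simp only [auxF_prod]
  exact Integrable.fintype_prod (fun m => auxF_int o k l m)

lemma aux_pi {n : ℕ} (o k l : Fin n) :
    ∫ x : Fin n → ℝ, (1/√3 - Real.exp (-(x o)^2)) * (x k * x l) ∂(Measure.pi fun _ => gaussianReal 0 1)
      = if k = o ∧ l = o then 2 * √3 / 9 else 0 := by
  simp only [auxF_prod]
  rw [integral_fintype_prod_eq_prod]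
  by_cases hkl : k = l
  · subst hkl
    by_cases hk : k = o
    · subst hk
      rw [Finset.prod_eq_single k]
      · simp only [auxF, if_true, ← sq, and_self]
        exact aux_w2
      · intro b _ hb
        simp [auxF, hb]
      · simp
    · rw [if_neg (by tauto)]
      apply Finset.prod_eq_zero (Finset.mem_univ o)
      simp only [auxF, if_true, if_neg (Ne.symm hk), mul_one]
      exact aux_w0
  · rw [if_neg (by rintro ⟨rfl, rfl⟩; exact hkl rfl)]
    by_cases hk : k = o
    · apply Finset.prod_eq_zero (Finset.mem_univ l)
      have h1 : l ≠ o := fun h => hkl (hk.trans h.symm)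
      simp [auxF, h1, Ne.symm hkl]
    · apply Finset.prod_eq_zero (Finset.mem_univ k)
      simp [auxF, hk, hkl]

lemma aux_basis {n : ℕ} (u : EuclideanSpace ℝ (Fin n)) (hu : ‖u‖ = 1) (o : Fin n) :
    ∃ b : OrthonormalBasis (Fin n) ℝ (EuclideanSpace ℝ (Fin n)), b o = u := by
  obtain ⟨b, hb⟩ := Orthonormal.exists_orthonormalBasis_extension_of_card_eq (𝕜 := ℝ)
    (E := EuclideanSpace ℝ (Fin n)) (ι := Fin n) (by simp) (v := fun _ => u) (s := {o}) (by
      refine ⟨fun i => by simpa using hu, fun i j hij => (hij (Subsingleton.elim _ _)).elim⟩)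
  exact ⟨b, hb o rfl⟩

lemma aux_rot {n : ℕ} (b : OrthonormalBasis (Fin n) ℝ (EuclideanSpace ℝ (Fin n))) :
    (Measure.pi fun _ : Fin n => gaussianReal 0 1) =
    (Measure.pi fun _ : Fin n => gaussianReal 0 1).map (fun x i => ∑ k, x k * b k i) := by
  have h := map_pi_eq_stdGaussian (ι := Fin n)
  rw [stdGaussian_eq_map_pi_orthonormalBasis b] at h
  have h2 := congrArg (Measure.map (WithLp.ofLp (p := 2) (V := Fin n → ℝ))) h
  rw [Measure.map_map (by fun_prop) (by fun_prop), Measure.map_map (by fun_prop) (by fun_prop)] at h2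
  convert h2 using 1
  · exact (Measure.map_id).symm
  · congr 1
    ext x i
    simp

/-- For a standard real Gaussian `a ~ N(0, I)` and fixed nonzero `z ∈ ℝⁿ`,
`E[(1/√3 − exp(−(aᵀz)²/‖z‖²)) a aᵀ] = (2√3/(9‖z‖²)) z zᵀ` (entrywise). -/
theorem expectation_real_init_matrix {n : ℕ} (z : Fin n → ℝ) (hz : z ≠ 0)
    (N : ℝ) (hN : N = ∑ k, (z k)^2) :
    ∀ i j : Fin n,
      ∫ a, (1/Real.sqrt 3 - Real.exp (-(∑ k, a k * z k)^2 / N)) * (a i * a j)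
          ∂(stdRealGaussian n)
        = (2 * Real.sqrt 3 / (9 * N)) * (z i * z j) := by
  intro i j
  set Z : EuclideanSpace ℝ (Fin n) := WithLp.toLp 2 z with hZ
  have hZ0 : Z ≠ 0 := by
    intro h
    apply hz
    simpa [hZ] using h
  have hr : ‖Z‖ ≠ 0 := norm_ne_zero_iff.2 hZ0
  have hNZ : N = ‖Z‖ ^ 2 := by rw [hN, EuclideanSpace.real_norm_sq_eq]
  obtain ⟨b, hb⟩ := aux_basis (‖Z‖⁻¹ • Z) (by rw [norm_smul, norm_inv, norm_norm, inv_mul_cancel₀ hr]) i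
  have hbz : ∀ m, z m = ‖Z‖ * b i m := by
    intro m
    rw [hb]
    change z m = ‖Z‖ * (‖Z‖⁻¹ * z m)
    rw [← mul_assoc, mul_inv_cancel₀ hr, one_mul]
  have hdot : ∀ x : Fin n → ℝ, ∑ m, (∑ k, x k * b k m) * z m = ‖Z‖ * x i := by
    intro x
    have h1 : ∀ k, ∑ m, b k m * b i m = if k = i then 1 else 0 := by
      intro k
      have := orthonormal_iff_ite.1 b.orthonormal k i
      rw [← this, PiLp.inner_apply]
      simp [mul_comm]
    calc _ = ‖Z‖ * ∑ k, x k * ∑ m, b k m * b i m := by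
          simp only [hbz, Finset.sum_mul, Finset.mul_sum]
          rw [Finset.sum_comm]
          refine Finset.sum_congr rfl fun k _ => Finset.sum_congr rfl fun m _ => by ring
      _ = _ := by simp [h1]
  unfold stdRealGaussian
  rw [aux_rot b, integral_map (Measurable.aemeasurable (by fun_prop)) (by
    apply Measurable.aestronglyMeasurable; fun_prop)]
  have hpt : ∀ x : Fin n → ℝ, (1/Real.sqrt 3 - Real.exp (-(∑ m, (∑ k, x k * b k m) * z m)^2 / N)) *
      ((∑ k, x k * b k i) * (∑ k, x k * b k j)) =
      ∑ k, ∑ l, (b k i * b l j) * ((1/√3 - Real.exp (-(x i)^2)) * (x k * x l)) := by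
    intro x
    rw [hdot, hNZ, show -(‖Z‖ * x i)^2 / ‖Z‖^2 = -(x i)^2 by field_simp,
      Finset.sum_mul_sum, Finset.mul_sum]
    refine Finset.sum_congr rfl fun k _ => ?_
    rw [Finset.mul_sum]
    refine Finset.sum_congr rfl fun l _ => by ring
  simp only [hpt]
  rw [integral_finsetSum _ (fun k _ => integrable_finsetSum _ fun l _ => (aux_pi_int i k l).const_mul _)]
  have : ∀ k, ∫ x : Fin n → ℝ, ∑ l, (b k i * b l j) * ((1/√3 - Real.exp (-(x i)^2)) * (x k * x l)) ∂(Measure.pi fun _ => gaussianReal 0 1)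
     = ∑ l, (b k i * b l j) * (if k = i ∧ l = i then 2 * √3 / 9 else 0) := by
    intro k
    rw [integral_finsetSum _ (fun l _ => (aux_pi_int i k l).const_mul _)]
    refine Finset.sum_congr rfl fun l _ => ?_
    rw [integral_const_mul, aux_pi]
  simp only [this]
  rw [Finset.sum_eq_single i (by intro k _ hk; simp [hk]) (by simp),
    Finset.sum_eq_single i (by intro k _ hk; simp [hk]) (by simp)]
  rw [hbz i, hbz j, hNZ]
  simp
  field_simp
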